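/- arXiv:1110.1862 — 2 statements merged into one kernel-verified Lean document; each statement's English description precedes it below -/
import Mathlib

section
/- Let L be a finite set of N players, let f be a function from subsets of L to the reals, and define the multilinear extension h : ℝ^L → ℝ by h(x) = Σ_{R ⊆ L} (Π_{i ∈ R} x_i) · (Π_{i ∈ L \ R} (1 − x_i)) · f(R). Then for every player i ∈ L and every x ∈ ℝ^L, the partial derivative of h with respect to x_i equals Σ_{R ⊆ L \ {i}} (Π_{j ∈ R} x_j) · (Π_{j ∈ (L \ {i}) \ R} (1 − x_j)) · (f(R ∪ {i}) − f(R)). -/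
open Finset

/-- The multilinear extension of the cooperative game on player set `L` with
characteristic function `f`. -/
noncomputable def mle {ι : Type*} [DecidableEq ι] (L : Finset ι)
    (f : Finset ι → ℝ) (x : ι → ℝ) : ℝ :=
  ∑ R ∈ L.powerset, (∏ i ∈ R, x i) * (∏ i ∈ L \ R, (1 - x i)) * f R

/-- Splitting the coalitions of `insert i K` according to whether they contain `i`. -/
theorem mle_insert {ι : Type*} [DecidableEq ι] {K : Finset ι} {i : ι} (hi : i ∉ K)
    (f : Finset ι → ℝ) (x : ι → ℝ) :
    mle (insert i K) f x =
      ∑ R ∈ K.powerset, (∏ j ∈ R, x j) * (∏ j ∈ K \ R, (1 - x j)) *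
        (f R + x i * (f (insert i R) - f R)) := by
  rw [mle, sum_powerset_insert hi, ← sum_add_distrib]
  refine sum_congr rfl fun R hR => ?_
  have hiR : i ∉ R := fun h => hi (mem_powerset.mp hR h)
  rw [insert_sdiff_of_notMem _ hiR, insert_sdiff_insert, sdiff_insert_of_notMem hi,
    prod_insert hiR, prod_insert (fun h => hi (mem_sdiff.mp h).1)]
  ring

/-- Partial derivative of the multilinear extension with respect to the
variable of player `i`. -/
theorem mle_partial_deriv {ι : Type*} [DecidableEq ι] (L : Finset ι)
    (f : Finset ι → ℝ) (i : ι) (hi : i ∈ L) (x : ι → ℝ) :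
    HasDerivAt (fun t : ℝ => mle L f (Function.update x i t))
      (∑ R ∈ (L.erase i).powerset,
        (∏ j ∈ R, x j) * (∏ j ∈ (L.erase i) \ R, (1 - x j))
          * (f (insert i R) - f R))
      (x i) := by
  have key : ∀ t : ℝ, mle L f (Function.update x i t) =
      ∑ R ∈ (L.erase i).powerset, (∏ j ∈ R, x j) * (∏ j ∈ (L.erase i) \ R, (1 - x j)) *
        (f R + t * (f (insert i R) - f R)) := fun t => by
    have hx : ∀ j ∈ L.erase i, Function.update x i t j = x j := fun j hj =>
      Function.update_of_ne (ne_of_mem_erase hj) _ _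
    conv_lhs => rw [← insert_erase hi]
    rw [mle_insert (notMem_erase i L)]
    refine sum_congr rfl fun R hR => ?_
    rw [Function.update_self, prod_congr rfl fun j hj => hx j (mem_powerset.mp hR hj),
      prod_congr rfl fun j hj => congrArg (1 - ·) (hx j (mem_sdiff.mp hj).1)]
  simp only [key]
  refine HasDerivAt.fun_sum fun R _ => HasDerivAt.const_mul _ ?_
  simpa using ((hasDerivAt_id (x i)).mul_const (f (insert i R) - f R)).const_add (f R)
end

section
/- Let L be a finite set of N ≥ 1 players, let f be a function from subsets of L to the reals, and define the multilinear extension h : ℝ^L → ℝ by h(x) = Σ_{R ⊆ L} (Π_{i ∈ R} x_i) · (Π_{i ∈ L \ R} (1 − x_i)) · f(R). Then for every player i ∈ L, ∫_0^1 (∂h/∂x_i)(t, t, …, t) dt = Σ_{R ⊆ L, i ∈ R} ((|R| − 1)! · (N − |R|)! / N!) · (f(R) − f(R \ {i})), i.e., integrating the i-th partial derivative of h along the main diagonal of the unit cube yields the Shapley value of player i. -/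
open Finset

theorem integral_pow_mul_one_sub_pow (a b : ℕ) :
    ∫ t in (0:ℝ)..1, t ^ a * (1 - t) ^ b =
      (a.factorial * b.factorial : ℝ) / (a + b + 1).factorial := by
  induction b generalizing a with
  | zero =>
    simp only [pow_zero, mul_one, integral_pow, add_zero, Nat.factorial_succ a]
    have := Nat.factorial_ne_zero a
    push_cast
    field_simp
    simp
  | succ b ih =>
    have hderiv : ∀ t ∈ Set.uIcc (0:ℝ) 1,
        HasDerivAt (fun t : ℝ => t ^ (a + 1) * (1 - t) ^ (b + 1))
          ((a + 1) * (t ^ a * (1 - t) ^ (b + 1)) - (b + 1) * (t ^ (a + 1) * (1 - t) ^ b)) t := by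
      intro t _
      refine ((hasDerivAt_pow (a + 1) t).fun_mul
        (((hasDerivAt_id' t).const_sub 1).fun_pow (b + 1))).congr_deriv ?_
      simp only [Nat.add_sub_cancel]
      push_cast
      ring
    have hint := intervalIntegral.integral_eq_sub_of_hasDerivAt hderiv
      (Continuous.intervalIntegrable (by fun_prop) _ _)
    rw [intervalIntegral.integral_sub (Continuous.intervalIntegrable (by fun_prop) _ _)
      (Continuous.intervalIntegrable (by fun_prop) _ _), intervalIntegral.integral_const_mul,
      intervalIntegral.integral_const_mul, ih] at hint
    have ha : (a + 1 : ℝ) ≠ 0 := by positivity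
    refine mul_left_cancel₀ ha ?_
    rw [show a + (b + 1) + 1 = a + 1 + b + 1 by ring, Nat.factorial_succ b]
    rw [Nat.factorial_succ a] at hint
    simp at hint
    push_cast
    linear_combination hint

theorem mle_insert_update {ι : Type*} [DecidableEq ι] {M : Finset ι} {i : ι} (hi : i ∉ M)
    (f : Finset ι → ℝ) (x : ι → ℝ) (s : ℝ) :
    mle (insert i M) f (Function.update x i s) =
      ∑ S ∈ M.powerset, (∏ j ∈ S, x j) * (∏ j ∈ M \ S, (1 - x j)) *
        ((1 - s) * f S + s * f (insert i S)) := by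
  have hupdate : ∀ T ⊆ M, ∀ j ∈ T, Function.update x i s j = x j := fun T hT j hj =>
    Function.update_of_ne (ne_of_mem_of_not_mem (hT hj) hi) _ _
  rw [mle, sum_powerset_insert hi, ← sum_add_distrib]
  refine sum_congr rfl fun S hS => ?_
  rw [mem_powerset] at hS
  have hiS : i ∉ S := fun h => hi (hS h)
  have hprod : ∏ j ∈ S, Function.update x i s j = ∏ j ∈ S, x j := prod_congr rfl (hupdate S hS)
  have hprod' : ∏ j ∈ M \ S, (1 - Function.update x i s j) = ∏ j ∈ M \ S, (1 - x j) :=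
    prod_congr rfl fun j hj => by rw [hupdate _ sdiff_subset j hj]
  rw [insert_sdiff_of_notMem _ hiS, insert_sdiff_insert, sdiff_insert_of_notMem hi,
    prod_insert (by simp [hi]), prod_insert hiS, hprod, hprod', Function.update_self]
  ring

theorem hasDerivAt_mle_insert_update {ι : Type*} [DecidableEq ι] {M : Finset ι} {i : ι}
    (hi : i ∉ M) (f : Finset ι → ℝ) (x : ι → ℝ) (s : ℝ) :
    HasDerivAt (fun s => mle (insert i M) f (Function.update x i s))
      (∑ S ∈ M.powerset, (∏ j ∈ S, x j) * (∏ j ∈ M \ S, (1 - x j)) *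
        (f (insert i S) - f S)) s := by
  simp only [mle_insert_update hi]
  refine HasDerivAt.fun_sum fun S _ => ?_
  refine (((((hasDerivAt_id' s).const_sub 1).mul_const (f S)).fun_add
    ((hasDerivAt_id' s).mul_const (f (insert i S)))).const_mul
    ((∏ j ∈ S, x j) * (∏ j ∈ M \ S, (1 - x j)))).congr_deriv ?_
  ring

/-- Owen's formula: integrating the `i`-th partial derivative of the
multilinear extension along the main diagonal of the unit cube yields the
Shapley value of player `i`. -/
theorem shapley_eq_integral_mle_diag {ι : Type*} [DecidableEq ι] (L : Finset ι)
    (hN : 1 ≤ L.card) (f : Finset ι → ℝ) (i : ι) (hi : i ∈ L) :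
    ∫ t in (0:ℝ)..1,
        deriv (fun s : ℝ => mle L f (Function.update (Function.const ι t) i s)) t
      = ∑ R ∈ L.powerset.filter (fun R => i ∈ R),
          (((R.card - 1).factorial * (L.card - R.card).factorial : ℝ)
              / (L.card).factorial) * (f R - f (R.erase i)) := by
  obtain ⟨M, hiM, rfl⟩ : ∃ M, i ∉ M ∧ insert i M = L :=
    ⟨L.erase i, notMem_erase i L, insert_erase hi⟩
  simp only [(hasDerivAt_mle_insert_update hiM f _ _).deriv, Function.const_apply, prod_const]
  rw [intervalIntegral.integral_finsetSum fun S _ =>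
    Continuous.intervalIntegrable (by fun_prop) _ _, sum_filter, sum_powerset_insert hiM,
    sum_eq_zero (s := M.powerset) (f := fun S => if i ∈ S then _ else _), zero_add]
  · refine sum_congr rfl fun S hS => ?_
    rw [mem_powerset] at hS
    have hiS : i ∉ S := fun h => hiM (hS h)
    have hcard := card_le_card hS
    rw [intervalIntegral.integral_mul_const, integral_pow_mul_one_sub_pow,
      if_pos (mem_insert_self i S), erase_insert hiS, card_insert_of_notMem hiS,
      card_insert_of_notMem hiM, card_sdiff_of_subset hS, Nat.add_sub_cancel,
      Nat.add_sub_add_right, Nat.add_sub_cancel' hcard]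
  · exact fun S hS => if_neg fun h => hiM (mem_powerset.1 hS h)
end
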